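/- There exists a Σ¹₁ tree T ⊆ ℕ^{<ℕ} which is finitely branching (for every σ ∈ T, the set {n : σ⌢n ∈ T} is finite) with [T] nonempty, such that [T] is not Medvedev equivalent to any homogeneous subset of ℕ^ℕ, i.e., to any set of the form ∏ₙHₙ for a family (Hₙ) of subsets of ℕ (not required to be Σ¹₁). -/

import Mathlib

open Set

/-- Baire space. -/
abbrev Baire : Type := ℕ → ℕ

/-- The length-`n` initial segment of `x : Baire`, as a finite sequence. -/
def pre (x : Baire) (n : ℕ) : List ℕ := (List.range n).map x

/-- A Turing functional, presented by a total computable monotone map on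
finite sequences. -/
structure TuringFunctional where
  φ : List ℕ → List ℕ
  computable : Computable φ
  mono : ∀ σ τ : List ℕ, σ <+: τ → φ σ <+: φ τ

/-- `Φ` is defined on `x` with value `y`: every coordinate of `y` is eventually
output by `Φ` on initial segments of `x`. -/
def TuringFunctional.Eval (Φ : TuringFunctional) (x y : Baire) : Prop :=
  ∀ n, ∃ m, (Φ.φ (pre x m))[n]? = some (y n)

/-- Medvedev reducibility: some Turing functional is defined on every element
of `Q` and maps `Q` into `P`. -/
def MedvedevLE (P Q : Set Baire) : Prop :=
  ∃ Φ : TuringFunctional, ∀ x ∈ Q, ∃ y ∈ P, Φ.Eval x y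

/-- Strict Medvedev reducibility. -/
def MedvedevLT (P Q : Set Baire) : Prop := MedvedevLE P Q ∧ ¬ MedvedevLE Q P

/-- The homogeneous set `∏ₙ Aₙ`. -/
def homProd (A : ℕ → Set ℕ) : Set Baire := {x | ∀ n, x n ∈ A n}

/-- A family `(Aₙ)` of subsets of `ℕ` is uniformly `Σ¹₁`. -/
def UniformlySigma11 (A : ℕ → Set ℕ) : Prop :=
  ∃ R : ℕ × ℕ → List ℕ → Bool, Computable₂ R ∧
    ∀ n m : ℕ, m ∈ A n ↔ ∃ y : Baire, ∀ k, R (n, m) (pre y k) = true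

/-- A subset of Baire space is (lightface) `Σ¹₁`. -/
def Sigma11Set (S : Set Baire) : Prop :=
  ∃ R : List ℕ → List ℕ → Bool, Computable₂ R ∧
    ∀ x, x ∈ S ↔ ∃ y : Baire, ∀ m, R (pre x m) (pre y m) = true

/-- A set of finite sequences is (lightface) `Σ¹₁`. -/
def Sigma11List (T : Set (List ℕ)) : Prop :=
  ∃ R : List ℕ → List ℕ → Bool, Computable₂ R ∧
    ∀ σ, σ ∈ T ↔ ∃ y : Baire, ∀ m, R σ (pre y m) = true

/-- A tree on `ℕ`: a set of finite sequences closed under prefixes. -/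
def IsTree (T : Set (List ℕ)) : Prop := ∀ σ ∈ T, ∀ τ : List ℕ, τ <+: σ → τ ∈ T

/-- The set `[T]` of infinite paths through `T`. -/
def paths (T : Set (List ℕ)) : Set Baire := {x | ∀ n, pre x n ∈ T}

/-- A subset of `ℕ × ℕ` is (lightface) `Σ¹₁`. -/
def Sigma11Pairs (A : Set (ℕ × ℕ)) : Prop :=
  ∃ R : ℕ × ℕ → List ℕ → Bool, Computable₂ R ∧
    ∀ p : ℕ × ℕ, p ∈ A ↔ ∃ y : Baire, ∀ k, R p (pre y k) = true

/-- A function `f : ℕ → ℕ` is `Δ¹₁`: its graph is both `Σ¹₁` and `Π¹₁`. -/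
def Delta11Fun (f : ℕ → ℕ) : Prop :=
  Sigma11Pairs {p : ℕ × ℕ | f p.1 = p.2} ∧ Sigma11Pairs {p : ℕ × ℕ | f p.1 ≠ p.2}

/-! ### Initial segments -/

lemma pre_length (x : Baire) (n : ℕ) : (pre x n).length = n := by simp [pre]

lemma pre_succ (x : Baire) (n : ℕ) : pre x (n + 1) = pre x n ++ [x n] := by
  simp [pre, List.range_succ]

lemma pre_getElem? (x : Baire) {n i : ℕ} (h : i < n) : (pre x n)[i]? = some (x i) := by
  simp [pre, h]

lemma pre_take (x : Baire) {m n : ℕ} (h : m ≤ n) : (pre x n).take m = pre x m := by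
  simp [pre, List.take_range, h, ← List.map_take]

lemma pre_prefix (x : Baire) {m n : ℕ} (h : m ≤ n) : pre x m <+: pre x n :=
  pre_take x h ▸ List.take_prefix _ _

lemma pre_eq_iff (x z : Baire) (n : ℕ) : pre x n = pre z n ↔ ∀ i < n, x i = z i := by
  simp [pre]

/-- `l` is an initial segment of `x`. -/
def IsInitial (l : List ℕ) (x : Baire) : Prop := l = pre x l.length

lemma isInitial_pre (x : Baire) (n : ℕ) : IsInitial (pre x n) x := by
  simp [IsInitial, pre_length]

lemma IsInitial.of_prefix {l l' : List ℕ} {x : Baire} (h : IsInitial l' x) (hl : l <+: l') :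
    IsInitial l x := by
  have h1 := List.prefix_iff_eq_take.1 hl
  rw [h, pre_take x hl.length_le] at h1
  exact h1

lemma IsInitial.take_eq {l ρ : List ℕ} {x : Baire} (h : IsInitial l x)
    (hρ : ρ.length ≤ l.length) : ρ = l.take ρ.length ↔ IsInitial ρ x := by
  rw [h, pre_take x hρ, IsInitial]

lemma IsInitial.getElem {l : List ℕ} {x : Baire} {i v : ℕ} (h : IsInitial l x)
    (hi : l[i]? = some v) : x i = v := by
  have hlt : i < l.length := by
    by_contra hc
    simp [List.getElem?_eq_none (not_lt.1 hc)] at hi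
  rw [h, pre_getElem? x hlt] at hi
  exact Option.some.inj hi

lemma exists_isInitial {L : ℕ → List ℕ} (hL : ∀ i, L i <+: L (i + 1))
    (hlen : ∀ i, i ≤ (L i).length) : ∃ x : Baire, ∀ i, IsInitial (L i) x := by
  have mono : ∀ i j, i ≤ j → L i <+: L j := fun i j hij =>
    Nat.le_induction (List.prefix_refl _) (fun j _ ih => ih.trans (hL j)) j hij
  refine ⟨fun n => (L (n + 1)).getD n 0, fun i => ?_⟩
  refine List.ext_getElem? fun n => ?_
  by_cases hn : n < (L i).length
  · rw [pre_getElem? _ hn]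
    have hn' : n < (L (n + 1)).length := hlen (n + 1)
    have key : (L i)[n]? = (L (n + 1))[n]? := by
      rcases le_total i (n + 1) with h | h
      · obtain ⟨t, ht⟩ := mono _ _ h
        rw [← ht, List.getElem?_append_left hn]
      · obtain ⟨t, ht⟩ := mono _ _ h
        rw [← ht, List.getElem?_append_left hn']
    rw [key, List.getD_eq_getElem?_getD, List.getElem?_eq_getElem hn', Option.getD_some]
  · rw [List.getElem?_eq_none (not_lt.1 hn),
      List.getElem?_eq_none (by rw [pre_length]; exact not_lt.1 hn)]

/-! ### Turing functionals -/

namespace TuringFunctional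

lemma eval_stable {Φ : TuringFunctional} {x : Baire} {n m m' v : ℕ} (h : m ≤ m')
    (hv : (Φ.φ (pre x m))[n]? = some v) : (Φ.φ (pre x m'))[n]? = some v := by
  obtain ⟨t, ht⟩ := Φ.mono _ _ (pre_prefix x h)
  have hn : n < (Φ.φ (pre x m)).length := by
    by_contra hc
    simp [List.getElem?_eq_none (not_lt.1 hc)] at hv
  rw [← ht, List.getElem?_append_left hn, hv]

lemma Eval.unique_at {Φ : TuringFunctional} {x y : Baire} (h : Φ.Eval x y) {n m v : ℕ}
    (hv : (Φ.φ (pre x m))[n]? = some v) : v = y n := by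
  obtain ⟨m', hm'⟩ := h n
  have h1 := eval_stable (le_max_left m m') hv
  have h2 := eval_stable (le_max_right m m') hm'
  exact Option.some.inj (h1.symm.trans h2)

lemma Eval.exists_prefix {Φ : TuringFunctional} {x y : Baire} (h : Φ.Eval x y) (n : ℕ) :
    ∃ m, pre y n <+: Φ.φ (pre x m) := by
  have key : ∃ m, ∀ i < n, (Φ.φ (pre x m))[i]? = some (y i) := by
    choose f hf using h
    refine ⟨(Finset.range n).sup f, fun i hi => eval_stable ?_ (hf i)⟩
    exact Finset.le_sup (f := f) (Finset.mem_range.2 hi)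
  obtain ⟨m, hm⟩ := key
  refine ⟨m, List.prefix_iff_getElem?.2 fun i hi => ?_⟩
  rw [pre_length] at hi
  rw [hm i hi]
  simp [pre]

/-- Composition of Turing functionals. -/
def comp (Ψ Φ : TuringFunctional) : TuringFunctional where
  φ σ := Ψ.φ (Φ.φ σ)
  computable := Ψ.computable.comp Φ.computable
  mono _ _ h := Ψ.mono _ _ (Φ.mono _ _ h)

lemma Eval.comp {Ψ Φ : TuringFunctional} {x y z : Baire} (hΨ : Ψ.Eval y z) (hΦ : Φ.Eval x y) :
    (Ψ.comp Φ).Eval x z := by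
  intro n
  obtain ⟨k, hk⟩ := hΨ n
  obtain ⟨m, hm⟩ := hΦ.exists_prefix k
  refine ⟨m, ?_⟩
  obtain ⟨t, ht⟩ := Ψ.mono _ _ hm
  have hn : n < (Ψ.φ (pre y k)).length := by
    by_contra hc
    simp [List.getElem?_eq_none (not_lt.1 hc)] at hk
  change (Ψ.φ (Φ.φ (pre x m)))[n]? = _
  rw [← ht, List.getElem?_append_left hn, hk]

/-- The functional overwriting the beginning of its input by `l`. -/
def overwrite (l : List ℕ) : TuringFunctional where
  φ σ := l ++ σ.drop l.length
  computable := (Primrec.list_append.comp (Primrec.const l)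
    (Primrec.list_drop.comp (Primrec.const l.length) Primrec.id)).to_comp
  mono σ τ h := by
    obtain ⟨t, rfl⟩ := h
    rw [List.drop_append, ← List.append_assoc]
    exact List.prefix_append _ _

lemma overwrite_eval (a b : Baire) (k : ℕ) :
    (overwrite (pre a k)).Eval b (fun n => if n < k then a n else b n) := by
  intro n
  refine ⟨n + 1, ?_⟩
  change (pre a k ++ (pre b (n + 1)).drop (pre a k).length)[n]? = _
  by_cases h : n < k
  · rw [List.getElem?_append_left (by rwa [pre_length]), pre_getElem? _ h]
    simp [h]
  · rw [List.getElem?_append_right (by rw [pre_length]; omega), List.getElem?_drop, pre_length,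
      Nat.add_sub_cancel' (not_lt.1 h), pre_getElem? _ (Nat.lt_succ_self n)]
    simp [h]

end TuringFunctional

/-- A set with two Turing incomparable elements and no others is not Medvedev equivalent to a
homogeneous set. -/
lemma not_equiv_homProd_of_incomparable {x y : Baire}
    (hxy : ∀ Φ : TuringFunctional, ¬ Φ.Eval x y) (hyx : ∀ Φ : TuringFunctional, ¬ Φ.Eval y x)
    (H : ℕ → Set ℕ) :
    ¬ (MedvedevLE {x, y} (homProd H) ∧ MedvedevLE (homProd H) {x, y}) := by
  rintro ⟨⟨Ψ, hΨ⟩, ⟨Φ, hΦ⟩⟩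
  obtain ⟨a, ha, hxa⟩ := hΦ x (by simp)
  obtain ⟨b, hb, hyb⟩ := hΦ y (by simp)
  obtain ⟨c, hc, hac⟩ := hΨ a ha
  rcases hc with rfl | rfl
  swap
  · exact hxy _ (hac.comp hxa)
  have hne : c ≠ y := by
    rintro rfl
    exact hxy _ (hac.comp hxa)
  obtain ⟨i, hi⟩ := Function.ne_iff.1 hne
  obtain ⟨k, hk⟩ := hac i
  set a' : Baire := fun n => if n < k then a n else b n with ha'
  have hmem : a' ∈ homProd H := by
    intro n
    by_cases h : n < k
    · simpa [ha', h] using ha n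
    · simpa [ha', h] using hb n
  obtain ⟨c', hc', hac'⟩ := hΨ a' hmem
  have hpre : pre a' k = pre a k := (pre_eq_iff _ _ _).2 fun n hn => by simp [ha', hn]
  have hci : c i = c' i := hac'.unique_at (hpre ▸ hk)
  rcases hc' with rfl | rfl
  · exact hyx _ ((hac'.comp (TuringFunctional.overwrite_eval a b k)).comp hyb)
  · exact hi hci

/-! ### A Kleene–Post construction -/

namespace KleenePost

open Encodable Denumerable
open Nat.Partrec (Code)

/-- The finite sequence with a given code. -/
def decodeList (n : ℕ) : List ℕ := (decode (α := List ℕ) n).getD []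

lemma decodeList_encode (l : List ℕ) : decodeList (encode l) = l := by simp [decodeList]

/-- A state consists of two finite sequences and the number of the stage. -/
abbrev State : Type := List ℕ × List ℕ × ℕ

/-- The value at `p.1.length` output by the program `p.2.2 / 2` on the extension of the second
sequence coded by `t`, if the computation converges in the number of steps coded by `t`. -/
def search (p : State) (t : ℕ) : Option ℕ :=
  (Code.evaln t.unpair.2 (ofNat Code (p.2.2 / 2))
    (encode (p.2.1 ++ decodeList t.unpair.1))).bind fun v => (decodeList v)[p.1.length]?

/-- Extend the second sequence as prescribed by `t`, extend the first so as to disagree with the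
value found, and exchange the two. -/
def step (p : State) (t : ℕ) : State :=
  (p.2.1 ++ decodeList t.unpair.1, p.1 ++ [((search p t).map Nat.succ).getD 0], p.2.2 + 1)

/-- The least successful search parameter (`0` if there is none). -/
noncomputable def choice (p : State) : ℕ := sInf {t | (search p t).isSome = true}

/-- The states of the construction. -/
noncomputable def stage : ℕ → State
  | 0 => ([], [], 0)
  | s + 1 => step (stage s) (choice (stage s))

/-- The state reached from a given sequence of search parameters. -/
def run (w : List ℕ) : State := w.foldl step ([], [], 0)

/-- The condition that `r` does not refute the claim that `t` is `choice p`. -/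
def Consistent (p : State) (t r : ℕ) : Prop :=
  ((search p t).isSome = true ∧ ¬ (r < t ∧ (search p r).isSome = true)) ∨
    (t = 0 ∧ ¬ (search p r).isSome = true)

lemma forall_consistent_iff (p : State) (t : ℕ) : (∀ r, Consistent p t r) ↔ t = choice p := by
  constructor
  · intro h
    by_cases ht : (search p t).isSome = true
    · refine le_antisymm (le_csInf ⟨t, ht⟩ fun r ht' => ?_) (Nat.sInf_le ht)
      rcases h r with h' | h'
      · exact not_lt.1 fun hlt => h'.2 ⟨hlt, ht'⟩
      · exact absurd ht' h'.2
    · have h0 : ∀ r, t = 0 ∧ ¬ (search p r).isSome = true := fun r =>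
        (h r).resolve_left fun h' => ht h'.1
      have he : {t | (search p t).isSome = true} = ∅ :=
        eq_empty_of_forall_notMem fun r ht' => (h0 r).2 ht'
      rw [choice, he, Nat.sInf_empty, (h0 0).1]
  · rintro rfl r
    by_cases hne : {t | (search p t).isSome = true}.Nonempty
    · exact Or.inl ⟨Nat.sInf_mem hne, fun h => Nat.notMem_of_lt_sInf h.1 h.2⟩
    · have he := not_nonempty_iff_eq_empty.1 hne
      exact Or.inr ⟨by rw [choice, he, Nat.sInf_empty], fun h => hne ⟨r, h⟩⟩

/-! #### Effectivity -/

lemma primrec_decodeList : Primrec decodeList :=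
  Primrec.option_getD.comp Primrec.decode (Primrec.const [])

lemma primrec_search : Primrec₂ search := by
  have ht : Primrec fun a : State × ℕ => a.2.unpair := Primrec.unpair.comp Primrec.snd
  have h2 : Primrec fun a : State × ℕ => a.1.2 := Primrec.snd.comp Primrec.fst
  have hc : Primrec fun a : State × ℕ => ofNat Code (a.1.2.2 / 2) :=
    (Primrec.ofNat Code).comp
      (Primrec.nat_div.comp (Primrec.snd.comp h2) (Primrec.const 2))
  have hi : Primrec fun a : State × ℕ => encode (a.1.2.1 ++ decodeList a.2.unpair.1) :=
    Primrec.encode.comp (Primrec.list_append.comp (Primrec.fst.comp h2)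
      (primrec_decodeList.comp (Primrec.fst.comp ht)))
  have he := Code.primrec_evaln.comp (((Primrec.snd.comp ht).pair hc).pair hi)
  refine Primrec.option_bind he ?_
  exact Primrec.list_getElem?.comp (primrec_decodeList.comp Primrec.snd)
    (Primrec.list_length.comp (Primrec.fst.comp (Primrec.fst.comp Primrec.fst)))

lemma primrec_step : Primrec₂ step := by
  have ht : Primrec fun a : State × ℕ => a.2.unpair := Primrec.unpair.comp Primrec.snd
  have h2 : Primrec fun a : State × ℕ => a.1.2 := Primrec.snd.comp Primrec.fst
  have hv : Primrec fun a : State × ℕ => ((search a.1 a.2).map Nat.succ).getD 0 :=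
    Primrec.option_getD.comp
      (Primrec.option_map (primrec_search.comp Primrec.fst Primrec.snd)
        (Primrec.succ.comp Primrec.snd)) (Primrec.const 0)
  exact (Primrec.list_append.comp (Primrec.fst.comp h2)
    (primrec_decodeList.comp (Primrec.fst.comp ht))).pair
      ((Primrec.list_concat.comp (Primrec.fst.comp Primrec.fst) hv).pair
        (Primrec.succ.comp (Primrec.snd.comp h2)))

lemma primrec_run : Primrec run := by
  have h : Primrec₂ fun (_ : List ℕ) (a : State × ℕ) => step a.1 a.2 :=
    primrec_step.comp (Primrec.fst.comp Primrec.snd) (Primrec.snd.comp Primrec.snd)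
  exact Primrec.list_foldl Primrec.id (Primrec.const _) h

lemma primrecPred_consistent {α : Type} [Primcodable α] {f : α → State} {g h : α → ℕ}
    (hf : Primrec f) (hg : Primrec g) (hh : Primrec h) :
    PrimrecPred fun a => Consistent (f a) (g a) (h a) := by
  have hs : ∀ {k : α → ℕ}, Primrec k →
      PrimrecPred fun a => (search (f a) (k a)).isSome = true := fun hk =>
    Primrec.eq.comp (Primrec.option_isSome.comp (primrec_search.comp hf hk)) (Primrec.const true)
  exact ((hs hg).and ((Primrec.nat_lt.comp hh hg).and (hs hh)).not).or
    ((Primrec.eq.comp hg (Primrec.const 0)).and (hs hh).not)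

/-- The matrix of the `Σ¹₁` definition of the initial segments of the constructed reals: `w` is an
initial segment of a sequence of search parameters. -/
def WitnessMatrix (ρ w : List ℕ) : Prop :=
  (w = [] ∨ Consistent (run (w.take (w.length - 1).unpair.1))
    (w.getD (w.length - 1).unpair.1 0) (w.length - 1).unpair.2) ∧
  (w.length < 2 * ρ.length ∨ ρ = (run w).1.take ρ.length ∨ ρ = (run w).2.1.take ρ.length)

lemma primrecPred_matrix : PrimrecPred fun a : List ℕ × List ℕ => WitnessMatrix a.1 a.2 := by
  have hw : Primrec fun a : List ℕ × List ℕ => a.2 := Primrec.snd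
  have hl : Primrec fun a : List ℕ × List ℕ => a.2.length := Primrec.list_length.comp hw
  have hρ : Primrec fun a : List ℕ × List ℕ => a.1.length := Primrec.list_length.comp Primrec.fst
  have hu : Primrec fun a : List ℕ × List ℕ => (a.2.length - 1).unpair :=
    Primrec.unpair.comp (Primrec.nat_sub.comp hl (Primrec.const 1))
  have hs := Primrec.fst.comp hu
  have hr : Primrec fun a : List ℕ × List ℕ => run a.2 := primrec_run.comp hw
  refine PrimrecPred.and (PrimrecPred.or (Primrec.eq.comp hw (Primrec.const []))
    (primrecPred_consistent (primrec_run.comp (Primrec.list_take.comp hs hw))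
      ((Primrec.list_getD 0).comp hw hs) (Primrec.snd.comp hu)))
    (PrimrecPred.or (Primrec.nat_lt.comp hl (Primrec.nat_mul.comp (Primrec.const 2) hρ))
      (PrimrecPred.or ?_ ?_))
  · exact Primrec.eq.comp Primrec.fst (Primrec.list_take.comp hρ (Primrec.fst.comp hr))
  · exact Primrec.eq.comp Primrec.fst
      (Primrec.list_take.comp hρ (Primrec.fst.comp (Primrec.snd.comp hr)))

/-! #### Verification -/

lemma run_pre_succ (u : Baire) (s : ℕ) : run (pre u (s + 1)) = step (run (pre u s)) (u s) := by
  simp [run, pre_succ]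

lemma run_pre_choice (s : ℕ) : run (pre (fun i => choice (stage i)) s) = stage s := by
  induction s with
  | zero => rfl
  | succ s ih => rw [run_pre_succ, ih, stage]

lemma consistent_of_matrix {ρ : List ℕ} {u : Baire} (h : ∀ m, WitnessMatrix ρ (pre u m)) (s r : ℕ) :
    Consistent (run (pre u s)) (u s) r := by
  have h1 := (h (Nat.pair s r + 1)).1.resolve_left
    fun he => by simpa [pre_length] using congrArg List.length he
  have hlt : s < Nat.pair s r + 1 := Nat.lt_succ_of_le (Nat.left_le_pair s r)
  rw [pre_length, Nat.add_sub_cancel, Nat.unpair_pair, pre_take u hlt.le,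
    List.getD_eq_getElem?_getD, pre_getElem? u hlt] at h1
  exact h1

lemma run_pre_of_matrix {ρ : List ℕ} {u : Baire} (h : ∀ m, WitnessMatrix ρ (pre u m)) (s : ℕ) :
    run (pre u s) = stage s := by
  induction s with
  | zero => rfl
  | succ s ih =>
    rw [run_pre_succ, (forall_consistent_iff _ _).1 (consistent_of_matrix h s), ih, stage]

lemma matrix_pre_choice (m : ℕ) (ρ : List ℕ)
    (hρ : m < 2 * ρ.length ∨ ρ = (stage m).1.take ρ.length ∨ ρ = (stage m).2.1.take ρ.length) :
    WitnessMatrix ρ (pre (fun i => choice (stage i)) m) := by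
  refine ⟨?_, by rwa [run_pre_choice, pre_length]⟩
  rcases m with _ | m
  · exact Or.inl rfl
  · right
    have hlt : m.unpair.1 < m + 1 := Nat.lt_succ_of_le (Nat.unpair_left_le m)
    rw [pre_length, Nat.add_sub_cancel, pre_take _ hlt.le, List.getD_eq_getElem?_getD,
      pre_getElem? _ hlt, run_pre_choice]
    exact (forall_consistent_iff _ _).2 rfl _

lemma stage_snd_prefix (s : ℕ) : (stage s).2.1 <+: (stage (s + 1)).1 :=
  List.prefix_append _ _

lemma stage_fst_prefix (s : ℕ) : (stage s).1 <+: (stage (s + 1)).2.1 :=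
  List.prefix_append _ _

lemma stage_index (s : ℕ) : (stage s).2.2 = s := by
  induction s with
  | zero => rfl
  | succ s ih => rw [stage, step, ih]

lemma le_length_stage (s : ℕ) :
    s ≤ 2 * (stage s).1.length + 1 ∧ s ≤ 2 * (stage s).2.1.length := by
  induction s with
  | zero => simp
  | succ s ih =>
    have h1 := (stage_snd_prefix s).length_le
    have h2 : (stage (s + 1)).2.1.length = (stage s).1.length + 1 := by simp [stage, step]
    omega

lemma exists_limits : ∃ x y : Baire, ∀ i,
    (IsInitial (stage (2 * i)).1 x ∧ IsInitial (stage (2 * i)).2.1 y) ∧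
      (IsInitial (stage (2 * i + 1)).1 y ∧ IsInitial (stage (2 * i + 1)).2.1 x) := by
  have mono : ∀ s, (stage s).1 <+: (stage (s + 2)).1 := fun s =>
    (stage_fst_prefix s).trans (stage_snd_prefix (s + 1))
  obtain ⟨x, hx⟩ := exists_isInitial (L := fun i => (stage (2 * i)).1) (fun i => mono _)
    fun i => by have := (le_length_stage (2 * i)).1; omega
  obtain ⟨y, hy⟩ := exists_isInitial (L := fun i => (stage (2 * i + 1)).1) (fun i => mono _)
    fun i => by have := (le_length_stage (2 * i + 1)).1; omega
  exact ⟨x, y, fun i => ⟨⟨hx i, (hy i).of_prefix (stage_snd_prefix _)⟩, hy i,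
    (hx (i + 1)).of_prefix (stage_snd_prefix _)⟩⟩

/-- Every monotone computable map is treated by the search with the corresponding program. -/
lemma exists_index (Φ : TuringFunctional) :
    ∃ e, ∀ (σ τ : List ℕ) (s : ℕ), s / 2 = e →
      (∀ t v, search (σ, τ, s) t = some v →
        (Φ.φ (τ ++ decodeList t.unpair.1))[σ.length]? = some v) ∧
      (∀ α v, (Φ.φ (τ ++ α))[σ.length]? = some v →
        ∃ t, (search (σ, τ, s) t).isSome = true) := by
  obtain ⟨c, hc⟩ := Code.exists_code.1 Φ.computable
  have hcode : ∀ l : List ℕ, c.eval (encode l) = Part.some (encode (Φ.φ l)) := fun l => by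
    simp [hc]
  refine ⟨encode c, fun σ τ s hs => ?_⟩
  constructor
  · intro t v h
    simp only [search, hs, ofNat_encode, Option.bind_eq_some_iff] at h
    obtain ⟨n, hn, hv⟩ := h
    have h1 := Code.evaln_sound hn
    rw [hcode, Part.mem_some_iff] at h1
    rwa [h1, decodeList_encode] at hv
  · intro α v h
    have hmem : encode (Φ.φ (τ ++ α)) ∈ c.eval (encode (τ ++ α)) := by
      rw [hcode]; exact Part.mem_some _
    obtain ⟨k, hk⟩ := Code.evaln_complete.1 hmem
    refine ⟨Nat.pair (encode α) k, Option.isSome_iff_exists.2 ⟨v, ?_⟩⟩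
    simp only [search, hs, ofNat_encode, Option.bind_eq_some_iff, Nat.unpair_pair,
      decodeList_encode]
    exact ⟨_, hk, by rwa [decodeList_encode]⟩

lemma exists_diagonalizing_index (Φ : TuringFunctional) :
    ∃ e, ∀ s, s / 2 = e → ∀ x y : Baire, IsInitial (stage (s + 1)).1 y →
      IsInitial (stage (s + 1)).2.1 x → ¬ Φ.Eval y x := by
  obtain ⟨e, he⟩ := exists_index Φ
  refine ⟨e, fun s hs x y hy hx hΦ => ?_⟩
  have hidx := stage_index s
  obtain ⟨⟨σ, τ, s'⟩, hst⟩ : ∃ p, stage s = p := ⟨_, rfl⟩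
  rw [hst] at hidx
  obtain rfl : s' = s := hidx
  obtain ⟨hsound, hcomplete⟩ := he σ τ s' hs
  simp only [stage, hst, step] at hx hy
  set t := choice (σ, τ, s') with ht
  have hxn := hx.getElem (i := σ.length) (by simp; rfl)
  rcases hv : search (σ, τ, s') t with _ | v
  · obtain ⟨m, hm⟩ := hΦ σ.length
    have hm' := TuringFunctional.eval_stable (le_max_left m τ.length) hm
    have hτ : τ <+: pre y (max m τ.length) := by
      rw [(hy.of_prefix (List.prefix_append _ _) : IsInitial τ y), pre_length]
      exact pre_prefix y (le_max_right _ _)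
    obtain ⟨α, hα⟩ := hτ
    rw [← hα] at hm'
    have hmem := Nat.sInf_mem (s := {t | (search (σ, τ, s') t).isSome = true})
      (hcomplete α _ hm')
    change (search (σ, τ, s') t).isSome = true at hmem
    simp [hv] at hmem
  · have h1 := hsound t v hv
    rw [hy] at h1
    have h2 := hΦ.unique_at h1
    rw [hv] at hxn
    simp at hxn
    omega

/-- There are Turing incomparable reals whose initial segments form a `Σ¹₁` set. -/
lemma exists_sigma11_incomparable : ∃ x y : Baire,
    (∀ Φ : TuringFunctional, ¬ Φ.Eval x y) ∧ (∀ Φ : TuringFunctional, ¬ Φ.Eval y x) ∧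
      Sigma11List {ρ | IsInitial ρ x ∨ IsInitial ρ y} := by
  obtain ⟨x, y, h⟩ := exists_limits
  refine ⟨x, y, fun Φ hΦ => ?_, fun Φ hΦ => ?_, ?_⟩
  · obtain ⟨e, he⟩ := exists_diagonalizing_index Φ
    exact he (2 * e + 1) (by omega) y x (h (e + 1)).1.1 (h (e + 1)).1.2 hΦ
  · obtain ⟨e, he⟩ := exists_diagonalizing_index Φ
    exact he (2 * e) (by omega) x y (h e).2.1 (h e).2.2 hΦ
  · have key : ∀ (ρ : List ℕ) (m : ℕ), 2 * ρ.length ≤ m →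
        ((ρ = (stage m).1.take ρ.length ∨ ρ = (stage m).2.1.take ρ.length) ↔
          (IsInitial ρ x ∨ IsInitial ρ y)) := by
      intro ρ m hm
      have hlen := le_length_stage m
      have h1 : ρ.length ≤ (stage m).1.length := by omega
      have h2 : ρ.length ≤ (stage m).2.1.length := by omega
      rcases Nat.even_or_odd' m with ⟨i, rfl | rfl⟩
      · rw [(h i).1.1.take_eq h1, (h i).1.2.take_eq h2]
      · rw [(h i).2.1.take_eq h1, (h i).2.2.take_eq h2, or_comm]
    classical
    refine ⟨fun ρ w => decide (WitnessMatrix ρ w), primrecPred_matrix.decide.to_comp, fun ρ => ?_⟩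
    simp only [decide_eq_true_eq, mem_ofPred_eq]
    constructor
    · intro hρ
      refine ⟨fun i => choice (stage i), fun m => matrix_pre_choice m ρ ?_⟩
      rcases lt_or_ge m (2 * ρ.length) with hm | hm
      · exact Or.inl hm
      · exact Or.inr ((key ρ m hm).2 hρ)
    · rintro ⟨u, hu⟩
      have h1 := (hu (2 * ρ.length)).2.resolve_left (by simp [pre_length])
      rw [run_pre_of_matrix hu] at h1
      exact (key ρ _ le_rfl).1 h1

end KleenePost

lemma paths_isInitial_pair (x y : Baire) :
    paths {ρ | IsInitial ρ x ∨ IsInitial ρ y} = {x, y} := by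
  have hiff : ∀ (z u : Baire) (n : ℕ), IsInitial (pre z n) u ↔ ∀ i < n, z i = u i :=
    fun z u n => by rw [IsInitial, pre_length, pre_eq_iff]
  ext z
  simp only [paths, mem_ofPred_eq, hiff, mem_insert_iff, mem_singleton_iff]
  constructor
  · intro h
    by_contra! hne
    obtain ⟨i, hi⟩ := Function.ne_iff.1 hne.1
    obtain ⟨j, hj⟩ := Function.ne_iff.1 hne.2
    rcases h (max i j + 1) with h' | h'
    · exact hi (h' i (by omega))
    · exact hj (h' j (by omega))
  · rintro (rfl | rfl) n <;> simp

/-- There is a nonempty `Σ¹₁`-closed set given by a finitely branching `Σ¹₁`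
tree which is not Medvedev equivalent to any homogeneous subset of Baire
space. -/
theorem exists_finbranching_not_equiv_homogeneous :
    ∃ T : Set (List ℕ), IsTree T ∧ Sigma11List T ∧
      (∀ σ ∈ T, {n : ℕ | σ ++ [n] ∈ T}.Finite) ∧ (paths T).Nonempty ∧
      ∀ H : ℕ → Set ℕ,
        ¬ (MedvedevLE (paths T) (homProd H) ∧ MedvedevLE (homProd H) (paths T)) := by
  obtain ⟨x, y, hxy, hyx, hT⟩ := KleenePost.exists_sigma11_incomparable
  refine ⟨{ρ | IsInitial ρ x ∨ IsInitial ρ y},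
    fun σ hσ τ hτ => hσ.imp (·.of_prefix hτ) (·.of_prefix hτ), hT, fun σ _ => ?_, ?_, ?_⟩
  · refine (Set.toFinite {x σ.length, y σ.length}).subset fun n hn => ?_
    have hget : (σ ++ [n])[σ.length]? = some n := by simp
    exact hn.imp (fun h => (h.getElem hget).symm) fun h => (h.getElem hget).symm
  · rw [paths_isInitial_pair]
    exact ⟨x, by simp⟩
  · rw [paths_isInitial_pair]
    exact not_equiv_homProd_of_incomparable hxy hyx
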